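/- arXiv:2312.08312 — 2 statements merged into one kernel-verified Lean document; each statement's English description precedes it below -/
import Mathlib

section
/- Fix a nonnegative integer d and complex parameters ρ, σ* such that σ* + m ≠ 0 for all integers 0 ≤ m ≤ 2d + 3, ρ + m ≠ 0 for all integers 1 ≤ m ≤ d + 1, and σ* − ρ + m ≠ 0 for all integers 0 ≤ m ≤ d + 1. Then for all integers 0 ≤ x ≤ d and 0 ≤ i ≤ d, the following contiguity relation for the normalized Hahn functions holds: ((σ* + 1)/(ρ − σ*)) · (x − d − 1) · p_{x,i}(d; ρ, σ*) = ((d + 1 − i)(i + σ*)/(2i + σ*)) · p_{x,i}(d+1; ρ, σ*−1) + ((i + 1)(i + σ* + 2 + d)/(2i + σ* + 2)) · p_{x,i+1}(d+1; ρ, σ*−1). -/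
/-- Pochhammer symbol `(a)_k = a (a+1) ⋯ (a+k-1)`. -/
noncomputable def poch (a : ℂ) (k : ℕ) : ℂ := ∏ l ∈ Finset.range k, (a + l)

/-- Normalized Hahn function `p_{x,i}(d; ρ, σ*)`, with the convention that it
vanishes for negative `i`. -/
noncomputable def hahnP (d : ℕ) (ρ σs : ℂ) (x : ℕ) (i : ℤ) : ℂ :=
  if i < 0 then 0
  else
    (d.choose i.toNat : ℂ) * poch (ρ + 1) i.toNat * poch (2 + σs) d /
        (poch (σs - ρ + 1) i.toNat * poch (σs + 1 + (i.toNat : ℂ)) i.toNat *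
          poch (σs + 2 * (i.toNat : ℂ) + 2) (d - i.toNat)) *
      ∑ k ∈ Finset.range (min i.toNat x + 1),
        poch (-(i.toNat : ℂ)) k * poch ((i.toNat : ℂ) + 1 + σs) k * poch (-(x : ℂ)) k /
          (poch (ρ + 1) k * poch (-(d : ℂ)) k * (k.factorial : ℂ))

theorem poch_zero (a : ℂ) : poch a 0 = 1 := by
  simp [poch]

theorem poch_succ (a : ℂ) (k : ℕ) : poch a (k + 1) = poch a k * (a + k) := by
  simp [poch, Finset.prod_range_succ]

theorem poch_succ_left (a : ℂ) (k : ℕ) : poch a (k + 1) = a * poch (a + 1) k := by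
  induction k with
  | zero => simp [poch]
  | succ k ih =>
    rw [poch_succ, ih, poch_succ (a + 1)]
    push_cast
    ring

theorem poch_ne_zero {a : ℂ} {k : ℕ} (h : ∀ l < k, a + (l : ℂ) ≠ 0) : poch a k ≠ 0 :=
  Finset.prod_ne_zero_iff.mpr fun l hl => h l (Finset.mem_range.mp hl)

theorem poch_neg_natCast_eq_zero {n k : ℕ} (h : n < k) : poch (-(n : ℂ)) k = 0 :=
  Finset.prod_eq_zero (Finset.mem_range.mpr h) (by simp)

theorem poch_neg_natCast_ne_zero {n k : ℕ} (h : k ≤ n) : poch (-(n : ℂ)) k ≠ 0 := by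
  refine poch_ne_zero fun l hl h0 => ?_
  have h1 : (l : ℂ) = n := by linear_combination h0
  have h2 : l = n := by exact_mod_cast h1
  omega

/-- The `k`-th summand of the `₃F₂` series defining the Hahn functions. -/
noncomputable def hahnTerm (d : ℕ) (ρ σs : ℂ) (x i k : ℕ) : ℂ :=
  poch (-(i : ℂ)) k * poch ((i : ℂ) + 1 + σs) k * poch (-(x : ℂ)) k /
    (poch (ρ + 1) k * poch (-(d : ℂ)) k * (k.factorial : ℂ))

theorem hahnP_natCast (d : ℕ) (ρ σs : ℂ) (x i : ℕ) :
    hahnP d ρ σs x (i : ℤ) =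
      (d.choose i : ℂ) * poch (ρ + 1) i * poch (2 + σs) d /
        (poch (σs - ρ + 1) i * poch (σs + 1 + (i : ℂ)) i *
          poch (σs + 2 * (i : ℂ) + 2) (d - i)) *
      ∑ k ∈ Finset.range (x + 1), hahnTerm d ρ σs x i k := by
  have hsum : ∑ k ∈ Finset.range (min i x + 1), hahnTerm d ρ σs x i k =
      ∑ k ∈ Finset.range (x + 1), hahnTerm d ρ σs x i k := by
    refine Finset.sum_subset (Finset.range_mono (by omega)) fun k hk hk' => ?_
    rw [Finset.mem_range] at hk hk'
    rw [hahnTerm, poch_neg_natCast_eq_zero (n := i) (by omega)]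
    simp
  rw [← hsum]
  simp [hahnP, hahnTerm]

/-- Partial sums of the contiguity relation between the `₃F₂` series telescope. -/
theorem sum_hahnTerm_contiguity_partial (d : ℕ) (ρ σs : ℂ) (x i n : ℕ) (hn : n ≤ d)
    (hσ : 2 * (i : ℂ) + 1 + σs ≠ 0)
    (hρ : ∀ m : ℕ, 1 ≤ m → m ≤ d + 1 → ρ + (m : ℂ) ≠ 0) :
    ∑ k ∈ Finset.range (n + 1), (((x : ℂ) - d - 1) * hahnTerm d ρ σs x i k +
        (d + 1) * ((σs - ρ + i) / (2 * i + 1 + σs) * hahnTerm (d + 1) ρ (σs - 1) x i k +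
          (i + 1 + ρ) / (2 * i + 1 + σs) * hahnTerm (d + 1) ρ (σs - 1) x (i + 1) k)) =
      -(poch (-(i : ℂ)) n * poch ((i : ℂ) + 1 + σs) n * poch (-(x : ℂ)) (n + 1) /
        (poch (ρ + 1) n * poch (-(d : ℂ)) n * (n.factorial : ℂ))) := by
  induction n with
  | zero =>
    simp only [zero_add, Finset.sum_range_one, hahnTerm, poch_zero, poch_succ]
    generalize hs : 2 * (i : ℂ) + 1 + σs = s at *
    obtain rfl : σs = s - 2 * i - 1 := by linear_combination hs
    field_simp
    push_cast
    ring
  | succ n ih =>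
    rw [Finset.sum_range_succ, ih (by omega)]
    have hT : poch (ρ + 1) n ≠ 0 := poch_ne_zero fun l hl => by
      have := hρ (l + 1) (by omega) (by omega)
      push_cast at this
      convert this using 1
      ring
    have hT' : ρ + 1 + (n : ℂ) ≠ 0 := by
      have := hρ (n + 1) (by omega) (by omega)
      push_cast at this
      convert this using 1
      ring
    have hD : poch (-(d : ℂ)) n ≠ 0 := poch_neg_natCast_ne_zero (by omega)
    have hD' : -(d : ℂ) + n ≠ 0 := fun h0 => by
      have h1 : (n : ℂ) = d := by linear_combination h0
      have h2 : n = d := by exact_mod_cast h1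
      omega
    have hd : (d : ℂ) + 1 ≠ 0 := by exact_mod_cast d.succ_ne_zero
    have hf : (n.factorial : ℂ) ≠ 0 := by exact_mod_cast n.factorial_ne_zero
    have hn1 : (n : ℂ) + 1 ≠ 0 := by exact_mod_cast n.succ_ne_zero
    have eA : poch ((i : ℂ) + 1 + (σs - 1)) (n + 1) = (i + σs) * poch ((i : ℂ) + 1 + σs) n := by
      rw [poch_succ_left]
      ring_nf
    have eB : poch (-((i + 1 : ℕ) : ℂ)) (n + 1) = -(i + 1) * poch (-(i : ℂ)) n := by
      rw [poch_succ_left]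
      push_cast
      ring_nf
    have eC : poch (-((d + 1 : ℕ) : ℂ)) (n + 1) = -(d + 1) * poch (-(d : ℂ)) n := by
      rw [poch_succ_left]
      push_cast
      ring_nf
    have eE : ((i + 1 : ℕ) : ℂ) + 1 + (σs - 1) = i + 1 + σs := by
      push_cast
      ring
    simp only [hahnTerm, eA, eB, eC, eE, poch_succ, Nat.factorial_succ]
    push_cast
    generalize poch (-(i : ℂ)) n = P at *
    generalize poch ((i : ℂ) + 1 + σs) n = Q at *
    generalize poch (-(x : ℂ)) n = R at *
    generalize poch (ρ + 1) n = T at *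
    generalize poch (-(d : ℂ)) n = D at *
    generalize (n.factorial : ℂ) = F at *
    clear ih eA eB eC eE
    generalize hs : 2 * (i : ℂ) + 1 + σs = s at *
    obtain rfl : σs = s - 2 * i - 1 := by linear_combination hs
    field_simp
    ring

theorem sum_hahnTerm_contiguity (d : ℕ) (ρ σs : ℂ) (x i : ℕ) (hx : x ≤ d)
    (hσ : 2 * (i : ℂ) + 1 + σs ≠ 0)
    (hρ : ∀ m : ℕ, 1 ≤ m → m ≤ d + 1 → ρ + (m : ℂ) ≠ 0) :
    ((x : ℂ) - d - 1) * ∑ k ∈ Finset.range (x + 1), hahnTerm d ρ σs x i k =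
      -(d + 1) * ((σs - ρ + i) / (2 * i + 1 + σs) *
          ∑ k ∈ Finset.range (x + 1), hahnTerm (d + 1) ρ (σs - 1) x i k +
        (i + 1 + ρ) / (2 * i + 1 + σs) *
          ∑ k ∈ Finset.range (x + 1), hahnTerm (d + 1) ρ (σs - 1) x (i + 1) k) := by
  have h := sum_hahnTerm_contiguity_partial d ρ σs x i x hx hσ hρ
  rw [poch_neg_natCast_eq_zero (Nat.lt_succ_self x)] at h
  simp only [Finset.sum_add_distrib, ← Finset.mul_sum, mul_zero, zero_div, neg_zero] at h
  linear_combination h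

theorem hahn_contiguity_raise (d : ℕ) (ρ σs : ℂ)
    (hσ : ∀ m : ℕ, m ≤ 2 * d + 3 → σs + (m : ℂ) ≠ 0)
    (hρ : ∀ m : ℕ, 1 ≤ m → m ≤ d + 1 → ρ + (m : ℂ) ≠ 0)
    (hσρ : ∀ m : ℕ, m ≤ d + 1 → σs - ρ + (m : ℂ) ≠ 0)
    (x i : ℕ) (hx : x ≤ d) (hi : i ≤ d) :
    (σs + 1) / (ρ - σs) * ((x : ℂ) - d - 1) * hahnP d ρ σs x (i : ℤ) =
      ((d : ℂ) + 1 - i) * ((i : ℂ) + σs) / (2 * (i : ℂ) + σs) *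
          hahnP (d + 1) ρ (σs - 1) x (i : ℤ) +
        ((i : ℂ) + 1) * ((i : ℂ) + σs + 2 + d) / (2 * (i : ℂ) + σs + 2) *
          hahnP (d + 1) ρ (σs - 1) x ((i : ℤ) + 1) := by
  have hs (m : ℕ) (hm : m ≤ 2 * d + 3) (z : ℂ) (hz : z = σs + m) : z ≠ 0 := hz ▸ hσ m hm
  have h1 : 2 * (i : ℂ) + 1 + σs ≠ 0 := hs (2 * i + 1) (by omega) _ (by push_cast; ring)
  have h0 : 2 * (i : ℂ) + σs ≠ 0 := hs (2 * i) (by omega) _ (by push_cast; ring)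
  have h2 : 2 * (i : ℂ) + σs + 2 ≠ 0 := hs (2 * i + 2) (by omega) _ (by push_cast; ring)
  have hi0 : (i : ℂ) + σs ≠ 0 := hs i (by omega) _ (by ring)
  have hid : (i : ℂ) + σs + 2 + d ≠ 0 := hs (i + 2 + d) (by omega) _ (by push_cast; ring)
  have hr0 : ρ - σs ≠ 0 := fun h => hσρ 0 (by omega) (by push_cast; linear_combination -h)
  have hr0' : σs - ρ ≠ 0 := fun h => hr0 (by linear_combination -h)
  have hri : σs - ρ + i ≠ 0 := hσρ i (by omega)
  have hU : poch (σs - ρ + 1) i ≠ 0 := poch_ne_zero fun l hl h =>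
    hσρ (l + 1) (by omega) (by push_cast; linear_combination h)
  have hV : poch (σs + 1 + (i : ℂ)) i ≠ 0 := poch_ne_zero fun l hl =>
    hs (1 + i + l) (by omega) _ (by push_cast; ring)
  have hW : poch (σs + 2 * (i : ℂ) + 2) (d - i) ≠ 0 := poch_ne_zero fun l hl =>
    hs (2 * i + 2 + l) (by omega) _ (by push_cast; ring)
  have eM : poch (2 + (σs - 1)) (d + 1) = (σs + 1) * poch (2 + σs) d := by
    rw [poch_succ_left]
    ring_nf
  have eU' : poch (σs - 1 - ρ + 1) (i + 1) = (σs - ρ) * poch (σs - ρ + 1) i := by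
    rw [poch_succ_left]
    ring_nf
  have eU : poch (σs - 1 - ρ + 1) i = (σs - ρ) * poch (σs - ρ + 1) i / (σs - ρ + i) := by
    rw [eq_div_iff hri, ← eU', poch_succ]
    ring
  have eV : poch (σs - 1 + 1 + (i : ℂ)) i =
      (i + σs) * poch (σs + 1 + (i : ℂ)) i / (2 * i + σs) := by
    rw [eq_div_iff h0]
    have h := poch_succ (i + σs) i
    rw [poch_succ_left] at h
    rw [show (i : ℂ) + σs + 1 = σs + 1 + i by ring] at h
    rw [h, show σs - 1 + 1 + (i : ℂ) = i + σs by ring]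
    ring
  have eV' : poch (σs - 1 + 1 + ((i + 1 : ℕ) : ℂ)) (i + 1) =
      poch (σs + 1 + (i : ℂ)) i * (2 * i + 1 + σs) := by
    rw [show σs - 1 + 1 + ((i + 1 : ℕ) : ℂ) = σs + 1 + i by push_cast; ring, poch_succ]
    ring
  have eW : poch (σs - 1 + 2 * (i : ℂ) + 2) (d + 1 - i) =
      (2 * i + 1 + σs) * poch (σs + 2 * (i : ℂ) + 2) (d - i) := by
    rw [show d + 1 - i = d - i + 1 by omega, poch_succ_left]
    ring_nf
  have eW' : poch (σs - 1 + 2 * ((i + 1 : ℕ) : ℂ) + 2) (d + 1 - (i + 1)) =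
      poch (σs + 2 * (i : ℂ) + 2) (d - i) * (i + σs + 2 + d) / (2 * i + σs + 2) := by
    rw [eq_div_iff h2, show d + 1 - (i + 1) = d - i by omega]
    have h := poch_succ (σs + 2 * (i : ℂ) + 2) (d - i)
    rw [poch_succ_left, Nat.cast_sub hi] at h
    rw [show σs - 1 + 2 * ((i + 1 : ℕ) : ℂ) + 2 = σs + 2 * i + 2 + 1 by push_cast; ring]
    linear_combination h
  have hc : ((d + 1).choose i : ℂ) * (d + 1 - i) = (d + 1) * d.choose i := by
    have h := Nat.choose_mul_succ_eq d i
    have h' := congrArg (Nat.cast : ℕ → ℂ) h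
    push_cast [Nat.cast_sub (show i ≤ d + 1 by omega)] at h'
    linear_combination -h'
  have hc' : ((d + 1).choose (i + 1) : ℂ) * (i + 1) = (d + 1) * d.choose i := by
    exact_mod_cast (Nat.add_one_mul_choose_eq d i).symm
  have hS := sum_hahnTerm_contiguity d ρ σs x i hx h1 hρ
  rw [show (i : ℤ) + 1 = ((i + 1 : ℕ) : ℤ) by push_cast; rfl]
  simp only [hahnP_natCast, eM, eU, eU', eV, eV', eW, eW', poch_succ (ρ + 1)]
  have hA : ((d : ℂ) + 1 - i) * ((i : ℂ) + σs) / (2 * (i : ℂ) + σs) *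
      (((d + 1).choose i : ℂ) * poch (ρ + 1) i * ((σs + 1) * poch (2 + σs) d) /
        ((σs - ρ) * poch (σs - ρ + 1) i / (σs - ρ + i) *
          ((i + σs) * poch (σs + 1 + (i : ℂ)) i / (2 * i + σs)) *
          ((2 * i + 1 + σs) * poch (σs + 2 * (i : ℂ) + 2) (d - i)))) =
      (σs + 1) / (ρ - σs) * ((d.choose i : ℂ) * poch (ρ + 1) i * poch (2 + σs) d /
        (poch (σs - ρ + 1) i * poch (σs + 1 + (i : ℂ)) i *
          poch (σs + 2 * (i : ℂ) + 2) (d - i))) *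
        (-(d + 1) * ((σs - ρ + i) / (2 * i + 1 + σs))) := by
    rw [show ρ - σs = -(σs - ρ) by ring]
    generalize 2 * (i : ℂ) + 1 + σs = s₁ at h1 ⊢
    generalize 2 * (i : ℂ) + σs = s₀ at h0 ⊢
    generalize (i : ℂ) + σs = s at hi0 ⊢
    generalize σs - ρ + (i : ℂ) = r at hri ⊢
    generalize poch (σs + 2 * (i : ℂ) + 2) (d - i) = W at hW ⊢
    generalize poch (σs - ρ + 1) i = U at hU ⊢
    generalize poch (σs + 1 + (i : ℂ)) i = V at hV ⊢
    generalize σs - ρ = q at hr0' ⊢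
    field_simp
    linear_combination poch (ρ + 1) i * (σs + 1) * poch (2 + σs) d * hc
  have hB : ((i : ℂ) + 1) * ((i : ℂ) + σs + 2 + d) / (2 * (i : ℂ) + σs + 2) *
      (((d + 1).choose (i + 1) : ℂ) * (poch (ρ + 1) i * (ρ + 1 + i)) *
          ((σs + 1) * poch (2 + σs) d) /
        ((σs - ρ) * poch (σs - ρ + 1) i *
          (poch (σs + 1 + (i : ℂ)) i * (2 * i + 1 + σs)) *
          (poch (σs + 2 * (i : ℂ) + 2) (d - i) * (i + σs + 2 + d) / (2 * i + σs + 2)))) =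
      (σs + 1) / (ρ - σs) * ((d.choose i : ℂ) * poch (ρ + 1) i * poch (2 + σs) d /
        (poch (σs - ρ + 1) i * poch (σs + 1 + (i : ℂ)) i *
          poch (σs + 2 * (i : ℂ) + 2) (d - i))) *
        (-(d + 1) * ((i + 1 + ρ) / (2 * i + 1 + σs))) := by
    rw [show ρ - σs = -(σs - ρ) by ring]
    generalize 2 * (i : ℂ) + 1 + σs = s₁ at h1 ⊢
    generalize 2 * (i : ℂ) + σs + 2 = s₂ at h2 ⊢
    generalize (i : ℂ) + σs + 2 + d = s₃ at hid ⊢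
    generalize poch (σs + 2 * (i : ℂ) + 2) (d - i) = W at hW ⊢
    generalize poch (σs - ρ + 1) i = U at hU ⊢
    generalize poch (σs + 1 + (i : ℂ)) i = V at hV ⊢
    generalize σs - ρ = q at hr0' ⊢
    field_simp
    linear_combination poch (ρ + 1) i * (σs + 1) * poch (2 + σs) d * (ρ + 1 + i) * hc'
  rw [← mul_assoc (((d : ℂ) + 1 - i) * ((i : ℂ) + σs) / (2 * (i : ℂ) + σs)), hA,
    ← mul_assoc (((i : ℂ) + 1) * ((i : ℂ) + σs + 2 + d) / (2 * (i : ℂ) + σs + 2)), hB]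
  linear_combination (σs + 1) / (ρ - σs) * ((d.choose i : ℂ) * poch (ρ + 1) i *
    poch (2 + σs) d / (poch (σs - ρ + 1) i * poch (σs + 1 + (i : ℂ)) i *
      poch (σs + 2 * (i : ℂ) + 2) (d - i))) * hS
end

section
/- Fix a nonnegative integer d and nonzero complex parameters q, ρ, σ* such that ρ ≠ σ*, q^m ≠ 1 for all integers 1 ≤ m ≤ d + 1, ρ q^m ≠ 1 for all integers 1 ≤ m ≤ d + 1, σ* q^m ≠ 1 for all integers 0 ≤ m ≤ 2d + 4, and σ* q^m ≠ ρ for all integers 0 ≤ m ≤ d + 1. Then for all integers 0 ≤ x ≤ d and 0 ≤ i ≤ d, the following contiguity relation for the normalized q-Hahn functions holds: (1 − q^{d+1−x}) · ((1 − qσ*)/(ρ − σ*)) · p_{x,i}(d; ρ, σ*; q) = (q(1 − q^{i+1})(1 − σ* q^{i+2+d})/(1 − σ* q^{2i+2})) · p_{x,i+1}(d+1; ρ, σ*/q; q) + (q^{i+1}(1 − q^{d+1−i})(1 − σ* q^{i})/(1 − σ* q^{2i})) · p_{x,i}(d+1; ρ, σ*/q; q). -/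
/-- q-Pochhammer symbol `(a;q)_k`. -/
noncomputable def qpoch (a q : ℂ) (k : ℕ) : ℂ := ∏ l ∈ Finset.range k, (1 - a * q ^ l)

/-- q-binomial coefficient `[n choose i]_q` (set to `0` when `i > n`). -/
noncomputable def qbinom (q : ℂ) (n i : ℕ) : ℂ :=
  if i ≤ n then qpoch q q n / (qpoch q q i * qpoch q q (n - i)) else 0

/-- Normalized q-Hahn function `p_{x,i}(d; ρ, σ*; q)`, with the convention that it
vanishes for negative `i`. -/
noncomputable def qHahnP (d : ℕ) (ρ σs q : ℂ) (x : ℕ) (i : ℤ) : ℂ :=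
  if i < 0 then 0
  else
    qbinom q d i.toNat * qpoch (q * ρ) q i.toNat * qpoch (q ^ 2 * σs) q d /
        ((q * ρ) ^ i.toNat * qpoch (q * σs / ρ) q i.toNat *
          qpoch (σs * q ^ (i.toNat + 1)) q i.toNat *
          qpoch (σs * q ^ (2 * i.toNat + 2)) q (d - i.toNat)) *
      ∑ k ∈ Finset.range (min i.toNat x + 1),
        qpoch (q ^ (-(i.toNat : ℤ))) q k * qpoch (σs * q ^ (i.toNat + 1)) q k *
            qpoch (q ^ (-(x : ℤ))) q k * q ^ k /
          (qpoch (ρ * q) q k * qpoch (q ^ (-(d : ℤ))) q k * qpoch q q k)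


theorem qpoch_succ (a q : ℂ) (k : ℕ) :
    qpoch a q (k + 1) = qpoch a q k * (1 - a * q ^ k) :=
  Finset.prod_range_succ _ _

theorem qpoch_succ_left (a q : ℂ) (k : ℕ) :
    qpoch a q (k + 1) = (1 - a) * qpoch (a * q) q k := by
  simp only [qpoch, Finset.prod_range_succ', pow_zero, mul_one]
  rw [mul_comm]
  congr 1
  refine Finset.prod_congr rfl fun l _ => ?_
  ring

theorem qpoch_ne_zero {a q : ℂ} {k : ℕ} (h : ∀ l < k, a * q ^ l ≠ 1) : qpoch a q k ≠ 0 :=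
  Finset.prod_ne_zero_iff.2 fun l hl =>
    sub_ne_zero.2 (h l (Finset.mem_range.1 hl)).symm

theorem qpoch_zpow_neg_eq_zero {q : ℂ} (hq : q ≠ 0) {n k : ℕ} (h : n < k) :
    qpoch (q ^ (-(n : ℤ))) q k = 0 := by
  refine Finset.prod_eq_zero (Finset.mem_range.2 h) ?_
  rw [zpow_neg, zpow_natCast, inv_mul_cancel₀ (pow_ne_zero _ hq), sub_self]

theorem qpoch_zpow_neg_ne_zero {q : ℂ} (hq : q ≠ 0) {n k : ℕ} (hk : k ≤ n)
    (h : ∀ m : ℕ, 1 ≤ m → m ≤ n → q ^ m ≠ 1) : qpoch (q ^ (-(n : ℤ))) q k ≠ 0 := by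
  refine qpoch_ne_zero fun l hl e => h (n - l) (by omega) (by omega) ?_
  rw [zpow_neg, zpow_natCast, inv_mul_eq_one₀ (pow_ne_zero _ hq)] at e
  rw [pow_sub₀ _ hq (by omega), e, mul_inv_cancel₀ (pow_ne_zero _ hq)]

/-- The `k`-th term of the basic hypergeometric series `₃φ₂(a, b, c; e, f; q, q)`. -/
noncomputable def phiTerm (a b c e f q : ℂ) (k : ℕ) : ℂ :=
  qpoch a q k * qpoch b q k * qpoch c q k * q ^ k / (qpoch e q k * qpoch f q k * qpoch q q k)

/-- Partial sums of a three-term contiguity relation for `₃φ₂` telescope. -/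
theorem phiTerm_sum_telescope (u v X E ρ q : ℂ) (hE : 1 - E ≠ 0) (N : ℕ)
    (h₁ : ∀ k ≤ N, qpoch (ρ * q) q k ≠ 0) (h₂ : ∀ k ≤ N, qpoch (E * q) q k ≠ 0)
    (h₃ : ∀ k ≤ N, qpoch q q k ≠ 0) :
    (v - u) * (E - X) *
          ∑ k ∈ Finset.range (N + 1), phiTerm (u * q) (v * q) X (ρ * q) (E * q) q k -
        (E - 1) *
          ((ρ - u) * ∑ k ∈ Finset.range (N + 1), phiTerm u (v * q) X (ρ * q) E q k +
            (v - ρ) * ∑ k ∈ Finset.range (N + 1), phiTerm (u * q) v X (ρ * q) E q k) =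
      (v - u) * (qpoch (u * q) q N * qpoch (v * q) q N * qpoch X q (N + 1)) /
        (qpoch (ρ * q) q N * qpoch (E * q) q N * qpoch q q N) := by
  induction N with
  | zero => simp [phiTerm, qpoch]; ring
  | succ n ih =>
    have ih := ih (fun k hk => h₁ k (by omega)) (fun k hk => h₂ k (by omega))
      (fun k hk => h₃ k (by omega))
    have a₁ := h₁ (n + 1) le_rfl
    have a₂ := h₂ (n + 1) le_rfl
    have a₃ := h₃ (n + 1) le_rfl
    rw [qpoch_succ] at a₁ a₂ a₃
    obtain ⟨b₁, c₁⟩ := mul_ne_zero_iff.1 a₁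
    obtain ⟨b₂, c₂⟩ := mul_ne_zero_iff.1 a₂
    obtain ⟨b₃, c₃⟩ := mul_ne_zero_iff.1 a₃
    have key : (v - u) * (E - X) * phiTerm (u * q) (v * q) X (ρ * q) (E * q) q (n + 1) -
        (E - 1) * ((ρ - u) * phiTerm u (v * q) X (ρ * q) E q (n + 1) +
            (v - ρ) * phiTerm (u * q) v X (ρ * q) E q (n + 1)) =
      (v - u) * (qpoch (u * q) q (n + 1) * qpoch (v * q) q (n + 1) * qpoch X q (n + 1 + 1)) /
        (qpoch (ρ * q) q (n + 1) * qpoch (E * q) q (n + 1) * qpoch q q (n + 1)) -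
      (v - u) * (qpoch (u * q) q n * qpoch (v * q) q n * qpoch X q (n + 1)) /
        (qpoch (ρ * q) q n * qpoch (E * q) q n * qpoch q q n) := by
      simp only [phiTerm]
      rw [qpoch_succ_left u, qpoch_succ_left v, qpoch_succ_left E, qpoch_succ X q (n + 1)]
      simp only [qpoch_succ _ _ n, pow_succ]
      generalize qpoch (u * q) q n = U
      generalize qpoch (v * q) q n = V
      generalize qpoch X q n = Y
      generalize qpoch (ρ * q) q n = R at *
      generalize qpoch (E * q) q n = F at *
      generalize qpoch q q n = P at *
      generalize q ^ n = Q at *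
      generalize hr : 1 - ρ * q * Q = r at *
      field_simp
      subst hr
      ring
    rw [Finset.sum_range_succ _ (n + 1), Finset.sum_range_succ _ (n + 1),
      Finset.sum_range_succ _ (n + 1)]
    linear_combination ih + key

/-- The factor of `qHahnP` in front of its hypergeometric sum. -/
noncomputable def qHahnCoeff (d : ℕ) (ρ σs q : ℂ) (i : ℕ) : ℂ :=
  qbinom q d i * qpoch (q * ρ) q i * qpoch (q ^ 2 * σs) q d /
    ((q * ρ) ^ i * qpoch (q * σs / ρ) q i * qpoch (σs * q ^ (i + 1)) q i *
      qpoch (σs * q ^ (2 * i + 2)) q (d - i))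

theorem qHahnP_eq {q : ℂ} (hq : q ≠ 0) (d : ℕ) (ρ σs : ℂ) (x i : ℕ) :
    qHahnP d ρ σs q x (i : ℤ) = qHahnCoeff d ρ σs q i *
      ∑ k ∈ Finset.range (x + 1), phiTerm (q ^ (-(i : ℤ))) (σs * q ^ (i + 1))
        (q ^ (-(x : ℤ))) (ρ * q) (q ^ (-(d : ℤ))) q k := by
  rw [qHahnP, if_neg (by omega), Int.toNat_natCast]
  congr 1
  refine Finset.sum_subset (Finset.range_mono (by omega)) fun k hk hk' => ?_
  simp only [Finset.mem_range] at hk hk'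
  rw [qpoch_zpow_neg_eq_zero hq (by omega : i < k)]
  simp

theorem qHahnCoeff_succ_succ {d : ℕ} {q ρ σs : ℂ}
    (hq : q ≠ 0) (hρ0 : ρ ≠ 0) (hρσ : ρ ≠ σs)
    (hq1 : ∀ m : ℕ, 1 ≤ m → m ≤ d + 1 → q ^ m ≠ 1)
    (hσ : ∀ m : ℕ, m ≤ 2 * d + 4 → σs * q ^ m ≠ 1)
    (hσρ : ∀ m : ℕ, m ≤ d + 1 → σs * q ^ m ≠ ρ) {i : ℕ} (hi : i ≤ d) :
    q * (1 - q ^ (i + 1)) * (1 - σs * q ^ (i + 2 + d)) / (1 - σs * q ^ (2 * i + 2)) *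
        qHahnCoeff (d + 1) ρ (σs / q) q (i + 1) =
      (1 - q ^ (d + 1)) * ((1 - q * σs) / (ρ - σs)) * qHahnCoeff d ρ σs q i *
        ((1 - ρ * q ^ (i + 1)) / (1 - σs * q ^ (2 * i + 1))) := by
  have hP : ∀ k ≤ d + 1, qpoch q q k ≠ 0 := fun k hk => qpoch_ne_zero fun l hl => by
    rw [← pow_succ']; exact hq1 _ (by omega) (by omega)
  have hS : ∀ m k : ℕ, m + k ≤ 2 * d + 4 → qpoch (σs * q ^ m) q k ≠ 0 :=
    fun m k h => qpoch_ne_zero fun l hl => by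
      rw [mul_assoc, ← pow_add]; exact hσ _ (by omega)
  have hR : qpoch (q * σs / ρ) q i ≠ 0 := qpoch_ne_zero fun l hl e => by
    refine hσρ (l + 1) (by omega) ?_
    field_simp at e
    rw [← e]; ring
  have hs : ∀ m : ℕ, m ≤ 2 * d + 4 → 1 - σs * q ^ m ≠ 0 :=
    fun m hm => sub_ne_zero.2 (hσ m hm).symm
  have e₁ : 1 - q ^ (i + 1) ≠ 0 := sub_ne_zero.2 (hq1 _ (by omega) (by omega)).symm
  have e₂ : ρ - σs ≠ 0 := sub_ne_zero.2 hρσ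
  have e₃ := qpoch_succ (σs * q ^ (2 * i + 2)) q (d - i)
  rw [qpoch_succ_left, show σs * q ^ (2 * i + 2) * q ^ (d - i) = σs * q ^ (i + 2 + d) by
    rw [mul_assoc, ← pow_add]; congr 2; omega,
    show σs * q ^ (2 * i + 2) * q = σs * q ^ (2 * i + 3) by ring] at e₃
  have f₁ := hP i (by omega)
  have f₂ := hP (d - i) (by omega)
  have f₃ := hS (i + 1) i (by omega)
  have f₄ := hS (2 * i + 2) (d - i) (by omega)
  have f₅ := hS (2 * i + 3) (d - i) (by omega)
  have f₆ := hs (2 * i + 1) (by omega)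
  have f₇ := hs (2 * i + 2) (by omega)
  have g₁ : qpoch (σs / q * q ^ (i + 1 + 1)) q (i + 1) =
      qpoch (σs * q ^ (i + 1)) q i * (1 - σs * q ^ (2 * i + 1)) := by
    rw [show σs / q * q ^ (i + 1 + 1) = σs * q ^ (i + 1) by field_simp; ring, qpoch_succ]
    ring
  have g₂ : qpoch (σs / q * q ^ (2 * (i + 1) + 2)) q (d + 1 - (i + 1)) =
      qpoch (σs * q ^ (2 * i + 3)) q (d - i) := by
    congr 1
    · field_simp; ring
    · omega
  have g₃ : qpoch (q ^ 2 * (σs / q)) q (d + 1) = (1 - q * σs) * qpoch (q ^ 2 * σs) q d := by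
    rw [show q ^ 2 * (σs / q) = q * σs by field_simp, qpoch_succ_left,
      show q * σs * q = q ^ 2 * σs by ring]
  have g₄ : qpoch (q * (σs / q) / ρ) q (i + 1) = (ρ - σs) / ρ * qpoch (q * σs / ρ) q i := by
    rw [show q * (σs / q) / ρ = σs / ρ by field_simp, qpoch_succ_left,
      show σs / ρ * q = q * σs / ρ by ring]
    congr 1
    field_simp
  rw [qHahnCoeff, qHahnCoeff, g₁, g₂, g₃, g₄, qbinom, qbinom, if_pos (by omega), if_pos hi,
    Nat.add_sub_add_right, qpoch_succ q q d, qpoch_succ q q i, qpoch_succ (q * ρ),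
    show q * ρ * q ^ i = ρ * q ^ (i + 1) by ring, ← pow_succ', ← pow_succ']
  have e₄ : 1 - σs * q ^ (i + 2 + d) = (1 - σs * q ^ (2 * i + 2)) *
      qpoch (σs * q ^ (2 * i + 3)) q (d - i) / qpoch (σs * q ^ (2 * i + 2)) q (d - i) := by
    rw [e₃]; field_simp
  rw [e₄]
  generalize 1 - σs * q ^ (2 * i + 1) = s₁ at *
  generalize 1 - σs * q ^ (2 * i + 2) = s₂ at *
  generalize qpoch (σs * q ^ (2 * i + 2)) q (d - i) = z₁ at *
  generalize qpoch (σs * q ^ (2 * i + 3)) q (d - i) = z₂ at *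
  generalize qpoch (σs * q ^ (i + 1)) q i = z₃ at *
  generalize qpoch (q * σs / ρ) q i = z₄ at *
  generalize 1 - q ^ (i + 1) = z₅ at *
  generalize 1 - ρ * q ^ (i + 1) = z₆ at *
  field_simp
  ring

theorem qHahnCoeff_succ_left {d : ℕ} {q ρ σs : ℂ}
    (hq : q ≠ 0) (hρ0 : ρ ≠ 0) (hρσ : ρ ≠ σs)
    (hq1 : ∀ m : ℕ, 1 ≤ m → m ≤ d + 1 → q ^ m ≠ 1)
    (hσ : ∀ m : ℕ, m ≤ 2 * d + 4 → σs * q ^ m ≠ 1)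
    (hσρ : ∀ m : ℕ, m ≤ d + 1 → σs * q ^ m ≠ ρ) {i : ℕ} (hi : i ≤ d) :
    q ^ (i + 1) * (1 - q ^ (d + 1 - i)) * (1 - σs * q ^ i) / (1 - σs * q ^ (2 * i)) *
        qHahnCoeff (d + 1) ρ (σs / q) q i =
      (1 - q ^ (d + 1)) * ((1 - q * σs) / (ρ - σs)) * qHahnCoeff d ρ σs q i *
        (q ^ (i + 1) * (ρ - σs * q ^ i) / (1 - σs * q ^ (2 * i + 1))) := by
  have hP : ∀ k ≤ d + 1, qpoch q q k ≠ 0 := fun k hk => qpoch_ne_zero fun l hl => by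
    rw [← pow_succ']; exact hq1 _ (by omega) (by omega)
  have hS : ∀ m k : ℕ, m + k ≤ 2 * d + 4 → qpoch (σs * q ^ m) q k ≠ 0 :=
    fun m k h => qpoch_ne_zero fun l hl => by
      rw [mul_assoc, ← pow_add]; exact hσ _ (by omega)
  have hR : qpoch (q * σs / ρ) q i ≠ 0 := qpoch_ne_zero fun l hl e => by
    refine hσρ (l + 1) (by omega) ?_
    field_simp at e
    rw [← e]; ring
  have hs : ∀ m : ℕ, m ≤ 2 * d + 4 → 1 - σs * q ^ m ≠ 0 :=
    fun m hm => sub_ne_zero.2 (hσ m hm).symm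
  have e₁ : 1 - q ^ (d + 1 - i) ≠ 0 := sub_ne_zero.2 (hq1 _ (by omega) (by omega)).symm
  have e₂ : ρ - σs ≠ 0 := sub_ne_zero.2 hρσ
  have e₅ : ρ - σs * q ^ i ≠ 0 := sub_ne_zero.2 (hσρ i (by omega)).symm
  have f₁ := hP i (by omega)
  have f₂ := hP (d - i) (by omega)
  have f₃ := hS (i + 1) i (by omega)
  have f₄ := hS (2 * i + 2) (d - i) (by omega)
  have f₆ := hs (2 * i + 1) (by omega)
  have f₇ := hs (2 * i) (by omega)
  have f₈ := hs i (by omega)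
  have g₁ : qpoch (σs / q * q ^ (i + 1)) q i =
      (1 - σs * q ^ i) * qpoch (σs * q ^ (i + 1)) q i / (1 - σs * q ^ (2 * i)) := by
    rw [show σs / q * q ^ (i + 1) = σs * q ^ i by field_simp; ring, eq_div_iff f₇,
      show σs * q ^ (i + 1) = σs * q ^ i * q by ring, ← qpoch_succ_left, qpoch_succ]
    ring
  have g₂ : qpoch (σs / q * q ^ (2 * i + 2)) q (d + 1 - i) =
      (1 - σs * q ^ (2 * i + 1)) * qpoch (σs * q ^ (2 * i + 2)) q (d - i) := by
    rw [show σs / q * q ^ (2 * i + 2) = σs * q ^ (2 * i + 1) by field_simp; ring,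
      show d + 1 - i = d - i + 1 by omega, qpoch_succ_left]
    ring_nf
  have g₃ : qpoch (q ^ 2 * (σs / q)) q (d + 1) = (1 - q * σs) * qpoch (q ^ 2 * σs) q d := by
    rw [show q ^ 2 * (σs / q) = q * σs by field_simp, qpoch_succ_left,
      show q * σs * q = q ^ 2 * σs by ring]
  have g₄ : qpoch (q * (σs / q) / ρ) q i =
      (ρ - σs) * qpoch (q * σs / ρ) q i / (ρ - σs * q ^ i) := by
    have := qpoch_succ_left (σs / ρ) q i
    rw [qpoch_succ, show σs / ρ * q = q * σs / ρ by ring] at this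
    rw [show q * (σs / q) / ρ = σs / ρ by field_simp, eq_div_iff e₅]
    calc _ = ρ * (qpoch (σs / ρ) q i * (1 - σs / ρ * q ^ i)) := by field_simp
      _ = _ := by rw [this]; field_simp
  have g₅ : qpoch q q (d + 1 - i) = qpoch q q (d - i) * (1 - q ^ (d + 1 - i)) := by
    rw [show d + 1 - i = d - i + 1 by omega, qpoch_succ, ← pow_succ']
  rw [qHahnCoeff, qHahnCoeff, g₁, g₂, g₃, g₄, qbinom, qbinom, if_pos (by omega), if_pos hi,
    g₅, qpoch_succ q q d, ← pow_succ']
  generalize 1 - σs * q ^ (2 * i + 1) = s₁ at *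
  generalize 1 - σs * q ^ (2 * i) = s₂ at *
  generalize 1 - σs * q ^ i = s₃ at *
  generalize qpoch (σs * q ^ (2 * i + 2)) q (d - i) = z₁ at *
  generalize qpoch (σs * q ^ (i + 1)) q i = z₃ at *
  generalize qpoch (q * σs / ρ) q i = z₄ at *
  generalize 1 - q ^ (d + 1 - i) = z₅ at *
  generalize ρ - σs * q ^ i = z₆ at *
  field_simp

theorem qHahn_contiguity_raise (d : ℕ) (q ρ σs : ℂ)
    (hq : q ≠ 0) (hρ0 : ρ ≠ 0) (hσs0 : σs ≠ 0) (hρσ : ρ ≠ σs)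
    (hq1 : ∀ m : ℕ, 1 ≤ m → m ≤ d + 1 → q ^ m ≠ 1)
    (hρ : ∀ m : ℕ, 1 ≤ m → m ≤ d + 1 → ρ * q ^ m ≠ 1)
    (hσ : ∀ m : ℕ, m ≤ 2 * d + 4 → σs * q ^ m ≠ 1)
    (hσρ : ∀ m : ℕ, m ≤ d + 1 → σs * q ^ m ≠ ρ)
    (x i : ℕ) (hx : x ≤ d) (hi : i ≤ d) :
    (1 - q ^ (d + 1 - x)) * ((1 - q * σs) / (ρ - σs)) * qHahnP d ρ σs q x (i : ℤ) =
      q * (1 - q ^ (i + 1)) * (1 - σs * q ^ (i + 2 + d)) / (1 - σs * q ^ (2 * i + 2)) *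
          qHahnP (d + 1) ρ (σs / q) q x ((i : ℤ) + 1) +
        q ^ (i + 1) * (1 - q ^ (d + 1 - i)) * (1 - σs * q ^ i) / (1 - σs * q ^ (2 * i)) *
          qHahnP (d + 1) ρ (σs / q) q x (i : ℤ) := by
  have hq1' : (1 : ℂ) - q ^ (-((d + 1 : ℕ) : ℤ)) ≠ 0 := fun e => by
    refine hq1 (d + 1) (by omega) le_rfl ?_
    rw [zpow_neg, zpow_natCast, sub_eq_zero, eq_comm, inv_eq_one] at e
    exact e
  have hE : q ^ (-((d + 1 : ℕ) : ℤ)) * q = q ^ (-(d : ℤ)) := by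
    rw [← zpow_add_one₀ hq]; congr 1; push_cast; ring
  have hu : q ^ (-((i + 1 : ℕ) : ℤ)) * q = q ^ (-(i : ℤ)) := by
    rw [← zpow_add_one₀ hq]; congr 1; push_cast; ring
  have tel := phiTerm_sum_telescope (q ^ (-((i + 1 : ℕ) : ℤ))) (σs * q ^ i) (q ^ (-(x : ℤ)))
    (q ^ (-((d + 1 : ℕ) : ℤ))) ρ q hq1' x
    (fun k hk => qpoch_ne_zero fun l hl => by
      rw [mul_assoc, ← pow_succ']; exact hρ _ (by omega) (by omega))
    (fun k hk => by
      rw [hE]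
      exact qpoch_zpow_neg_ne_zero hq (by omega) fun m h h' => hq1 m h (by omega))
    (fun k hk => qpoch_ne_zero fun l hl => by
      rw [← pow_succ']; exact hq1 _ (by omega) (by omega))
  rw [qpoch_zpow_neg_eq_zero hq (Nat.lt_succ_self x), mul_zero, mul_zero, zero_div, hE, hu,
    show σs * q ^ i * q = σs * q ^ (i + 1) by ring] at tel
  have hi1 : ((i : ℤ) + 1) = ((i + 1 : ℕ) : ℤ) := by push_cast; rfl
  rw [hi1, qHahnP_eq hq, qHahnP_eq hq, qHahnP_eq hq, ← mul_assoc (_ / _) (qHahnCoeff _ _ _ _ _),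
    ← mul_assoc (_ / _) (qHahnCoeff _ _ _ _ _),
    qHahnCoeff_succ_succ hq hρ0 hρσ hq1 hσ hσρ hi, qHahnCoeff_succ_left hq hρ0 hρσ hq1 hσ hσρ hi,
    show σs / q * q ^ (i + 1 + 1) = σs * q ^ (i + 1) by field_simp; ring,
    show σs / q * q ^ (i + 1) = σs * q ^ i by field_simp; ring]
  have f : 1 - σs * q ^ (2 * i + 1) ≠ 0 := sub_ne_zero.2 (hσ _ (by omega)).symm
  generalize ∑ k ∈ Finset.range (x + 1), phiTerm (q ^ (-(i : ℤ))) (σs * q ^ (i + 1))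
    (q ^ (-(x : ℤ))) (ρ * q) (q ^ (-(d : ℤ))) q k = S₀ at *
  generalize ∑ k ∈ Finset.range (x + 1), phiTerm (q ^ (-((i + 1 : ℕ) : ℤ))) (σs * q ^ (i + 1))
    (q ^ (-(x : ℤ))) (ρ * q) (q ^ (-((d + 1 : ℕ) : ℤ))) q k = S₁ at *
  generalize ∑ k ∈ Finset.range (x + 1), phiTerm (q ^ (-(i : ℤ))) (σs * q ^ i)
    (q ^ (-(x : ℤ))) (ρ * q) (q ^ (-((d + 1 : ℕ) : ℤ))) q k = S₂ at *
  have core : (1 - q ^ (d + 1 - x)) * S₀ = (1 - q ^ (d + 1)) *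
      ((1 - ρ * q ^ (i + 1)) / (1 - σs * q ^ (2 * i + 1)) * S₁ +
        q ^ (i + 1) * (ρ - σs * q ^ i) / (1 - σs * q ^ (2 * i + 1)) * S₂) := by
    rw [pow_sub₀ _ hq (by omega)]
    simp only [zpow_neg, zpow_natCast] at tel
    have hqi : q ^ (i + 1) ≠ 0 := pow_ne_zero _ hq
    have hqd : q ^ (d + 1) ≠ 0 := pow_ne_zero _ hq
    have hqx : q ^ x ≠ 0 := pow_ne_zero _ hq
    have h2 : q ^ (2 * i + 1) = q ^ i * q ^ (i + 1) := by ring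
    rw [h2] at f ⊢
    generalize q ^ (i + 1) = Q at *
    generalize q ^ (d + 1) = D at *
    generalize q ^ x = Y at *
    generalize q ^ i = I at *
    generalize hr : 1 - σs * (I * Q) = r at *
    field_simp at tel ⊢
    subst hr
    linear_combination -tel
  linear_combination ((1 - q * σs) / (ρ - σs)) * qHahnCoeff d ρ σs q i * core
end
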